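/- arXiv:2310.05568 — 9 statements merged into one kernel-verified Lean document; each statement's English description precedes it below -/
import Mathlib

section
/- Let (f,s): (X,*,∘) ⇄ (Y,*,∘) be a split epimorphism of digroups with kernel K = f⁻¹(1). Then the map χ: X → X defined by χ(x) = (x * s(f(x))^{-*}) ∘ s(f(x)) is a bijection satisfying f∘χ = f, χ∘s = s, and χ(k) = k for all k ∈ K; moreover χ(k * s(y)) = k ∘ s(y) for all y ∈ Y and k ∈ K. -/
/-- A group structure on a type `X`, given by explicit data and axioms. -/
structure GroupLaw (X : Type*) where
  mul : X → X → X
  one : X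
  inv : X → X
  mul_assoc : ∀ a b c, mul (mul a b) c = mul a (mul b c)
  one_mul : ∀ a, mul one a = a
  mul_one : ∀ a, mul a one = a
  inv_mul : ∀ a, mul (inv a) a = one
  mul_inv : ∀ a, mul a (inv a) = one

/-- For a split epimorphism of digroups `(f,s) : (X,*,∘) ⇄ (Y,*,∘)` with
kernel `K = f⁻¹(1)`, the map `χ(x) = (x * s(f(x))^{-*}) ∘ s(f(x))` is a bijection with
`f ∘ χ = f`, `χ ∘ s = s`, `χ(k) = k` for `k ∈ K`, and `χ(k * s(y)) = k ∘ s(y)`. -/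
theorem stmt0 {X Y : Type*} (mX cX : GroupLaw X) (mY cY : GroupLaw Y)
    (hX : mX.one = cX.one) (hY : mY.one = cY.one)
    (f : X → Y) (s : Y → X)
    (hfm : ∀ a b, f (mX.mul a b) = mY.mul (f a) (f b))
    (hfc : ∀ a b, f (cX.mul a b) = cY.mul (f a) (f b))
    (hsm : ∀ a b, s (mY.mul a b) = mX.mul (s a) (s b))
    (hsc : ∀ a b, s (cY.mul a b) = cX.mul (s a) (s b))
    (hfs : ∀ y, f (s y) = y)
    (χ : X → X)
    (hχ : ∀ x, χ x = cX.mul (mX.mul x (mX.inv (s (f x)))) (s (f x))) :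
    Function.Bijective χ ∧ (∀ x, f (χ x) = f x) ∧ (∀ y, χ (s y) = s y) ∧
    (∀ k, f k = mY.one → χ k = k) ∧
    (∀ y k, f k = mY.one → χ (mX.mul k (s y)) = cX.mul k (s y)) := by
  have rc : ∀ {Z : Type _} (G : GroupLaw Z) (a b c : Z), G.mul a c = G.mul b c → a = b := by
    intro Z G a b c h
    have h2 := congrArg (fun z => G.mul z (G.inv c)) h
    simpa only [G.mul_assoc, G.mul_inv, G.mul_one] using h2
  have rcY : ∀ (G : GroupLaw Y) (a b c : Y), G.mul a c = G.mul b c → a = b := by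
    intro G a b c h
    have h2 := congrArg (fun z => G.mul z (G.inv c)) h
    simpa only [G.mul_assoc, G.mul_inv, G.mul_one] using h2
  have f1 : f mX.one = mY.one := by
    apply rcY mY _ _ (f mX.one)
    rw [← hfm, mX.one_mul, mY.one_mul]
  have s1 : s mY.one = mX.one := by
    apply rc mX _ _ (s mY.one)
    rw [← hsm, mX.one_mul, mY.one_mul]
  -- the `*`-kernel component lies in the kernel
  have hk : ∀ x, f (mX.mul x (mX.inv (s (f x)))) = mY.one := by
    intro x
    apply rcY mY _ _ (f x)
    have h : mX.mul (mX.mul x (mX.inv (s (f x)))) (s (f x)) = x := by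
      rw [mX.mul_assoc, mX.inv_mul, mX.mul_one]
    have h2 := congrArg f h
    rw [hfm, hfs] at h2
    rw [h2, mY.one_mul]
  have hk' : ∀ x, f (cX.mul x (cX.inv (s (f x)))) = mY.one := by
    intro x
    apply rcY cY _ _ (f x)
    have h : cX.mul (cX.mul x (cX.inv (s (f x)))) (s (f x)) = x := by
      rw [cX.mul_assoc, cX.inv_mul, cX.mul_one]
    have h2 := congrArg f h
    rw [hfc, hfs] at h2
    rw [h2, hY, cY.one_mul]
  have hfχ : ∀ x, f (χ x) = f x := by
    intro x
    rw [hχ, hfc, hk, hfs, hY, cY.one_mul]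
  have hlast : ∀ y k, f k = mY.one → χ (mX.mul k (s y)) = cX.mul k (s y) := by
    intro y k h
    rw [hχ, hfm, h, hfs, mY.one_mul, mX.mul_assoc, mX.mul_inv, mX.mul_one]
  refine ⟨⟨?_, ?_⟩, hfχ, ?_, ?_, hlast⟩
  · intro a b h
    have hf : f a = f b := by rw [← hfχ a, ← hfχ b, h]
    rw [hχ a, hχ b, hf] at h
    exact rc mX _ _ _ (rc cX _ _ _ h)
  · intro x
    refine ⟨mX.mul (cX.mul x (cX.inv (s (f x)))) (s (f x)), ?_⟩
    rw [hlast _ _ (hk' x), cX.mul_assoc, cX.inv_mul, cX.mul_one]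
  · intro y
    rw [hχ, hfs, mX.mul_inv, hX, cX.one_mul]
  · intro k h
    have := hlast mY.one k h
    rwa [s1, mX.mul_one, hX, cX.mul_one] at this
end

section
/- Let (f,s): (X,*,∘) ⇄ (Y,*,∘) be a split epimorphism of digroups with kernel K = f⁻¹(1). The following conditions are equivalent: (1) the index χ of (f,s) is the identity of X; (2) x ∘ s(f(x))^{-∘} = x * s(f(x))^{-*} for all x ∈ X; (3) k ∘ s(y) = k * s(y) for all (y,k) ∈ Y×K; (4) the skewing index is trivial, i.e. ξ_y = id_K for every y ∈ Y; (5) λ_k(s(y)) = s(y) for every k ∈ K and y ∈ Y. -/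
/-- For a split epimorphism of digroups `(f,s) : (X,*,∘) ⇄ (Y,*,∘)` with
kernel `K = f⁻¹(1)`, the following are equivalent:
(1) the index `χ(x) = (x * s(f(x))^{-*}) ∘ s(f(x))` is `id_X`;
(2) `x ∘ s(f(x))^{-∘} = x * s(f(x))^{-*}` for all `x`;
(3) `k ∘ s(y) = k * s(y)` for all `y ∈ Y`, `k ∈ K`;
(4) the skewing index `ξ_y(k) = (k ∘ s(y)) * s(y)^{-*}` is trivial;
(5) `λ_k(s(y)) = s(y)` for all `k ∈ K`, `y ∈ Y`, where `λ_k(b) = k^{-*} * (k ∘ b)`. -/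
theorem stmt2 {X Y : Type*} (mX cX : GroupLaw X) (mY cY : GroupLaw Y)
    (hX : mX.one = cX.one) (hY : mY.one = cY.one)
    (f : X → Y) (s : Y → X)
    (hfm : ∀ a b, f (mX.mul a b) = mY.mul (f a) (f b))
    (hfc : ∀ a b, f (cX.mul a b) = cY.mul (f a) (f b))
    (hsm : ∀ a b, s (mY.mul a b) = mX.mul (s a) (s b))
    (hsc : ∀ a b, s (cY.mul a b) = cX.mul (s a) (s b))
    (hfs : ∀ y, f (s y) = y)
    (χ : X → X)
    (hχ : ∀ x, χ x = cX.mul (mX.mul x (mX.inv (s (f x)))) (s (f x))) :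
    [ (∀ x, χ x = x),
      (∀ x, cX.mul x (cX.inv (s (f x))) = mX.mul x (mX.inv (s (f x)))),
      (∀ (y : Y) (k : X), f k = mY.one → cX.mul k (s y) = mX.mul k (s y)),
      (∀ (y : Y) (k : X), f k = mY.one →
        mX.mul (cX.mul k (s y)) (mX.inv (s y)) = k),
      (∀ (k : X) (y : Y), f k = mY.one →
        mX.mul (mX.inv k) (cX.mul k (s y)) = s y) ].TFAE := by
  have mc : ∀ a b, mX.mul (mX.mul a b) (mX.inv b) = a := fun a b => by
    rw [mX.mul_assoc, mX.mul_inv, mX.mul_one]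
  have mc' : ∀ a b, mX.mul (mX.mul a (mX.inv b)) b = a := fun a b => by
    rw [mX.mul_assoc, mX.inv_mul, mX.mul_one]
  have ml : ∀ a b, mX.mul (mX.inv a) (mX.mul a b) = b := fun a b => by
    rw [← mX.mul_assoc, mX.inv_mul, mX.one_mul]
  have ml' : ∀ a b, mX.mul a (mX.mul (mX.inv a) b) = b := fun a b => by
    rw [← mX.mul_assoc, mX.mul_inv, mX.one_mul]
  have cc : ∀ a b, cX.mul (cX.mul a b) (cX.inv b) = a := fun a b => by
    rw [cX.mul_assoc, cX.mul_inv, cX.mul_one]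
  have cc' : ∀ a b, cX.mul (cX.mul a (cX.inv b)) b = a := fun a b => by
    rw [cX.mul_assoc, cX.inv_mul, cX.mul_one]
  have yc : ∀ a b, mY.mul a b = b → a = mY.one := fun a b h => by
    have h2 : mY.mul (mY.mul a b) (mY.inv b) = a := by
      rw [mY.mul_assoc, mY.mul_inv, mY.mul_one]
    rw [← h2, h, mY.mul_inv]
  tfae_have 1 → 2 := by
    intro h x
    have h1 := h x
    rw [hχ] at h1
    have h2 := cc (mX.mul x (mX.inv (s (f x)))) (s (f x))
    rw [h1] at h2
    exact h2
  tfae_have 2 → 1 := by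
    intro h x
    rw [hχ, ← h x, cc']
  tfae_have 1 → 3 := by
    intro h y k hk
    have h1 := h (mX.mul k (s y))
    rw [hχ, hfm, hk, hfs, mY.one_mul, mc] at h1
    exact h1
  tfae_have 3 → 1 := by
    intro h x
    rw [hχ, h _ _ ?_, mc']
    apply yc _ (f x)
    have h1 := congrArg f (mc' x (s (f x)))
    rw [hfm, hfs] at h1
    exact h1
  tfae_have 3 → 4 := by
    intro h y k hk
    rw [h y k hk, mc]
  tfae_have 4 → 3 := by
    intro h y k hk
    have h1 := mc' (cX.mul k (s y)) (s y)
    rw [h y k hk] at h1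
    exact h1.symm
  tfae_have 3 → 5 := by
    intro h k y hk
    rw [h y k hk, ml]
  tfae_have 5 → 3 := by
    intro h y k hk
    have h1 := ml' k (cX.mul k (s y))
    rw [h k y hk] at h1
    exact h1.symm
  tfae_finish
end

section
/- Let (f,s): (X,*,∘) ⇄ (Y,*,∘) be a split epimorphism of digroups with kernel (K,*,∘), canonical *-action φ_* and skewing index ξ. Then the map θ: Y×K → X, θ(y,k) = k * s(y), is a bijection that is simultaneously a group isomorphism (Y×K, ⋉_{φ_*}) → (X,*) and (Y×K, ∘_ξ) → (X,∘) (where ∘_ξ is built from φ_∘ and ξ), and it satisfies f ∘ θ = p_Y and θ ∘ ι_Y = s; hence (f,s) is isomorphic in digroups to (p_Y, ι_Y): (Y×K, ⋉_{φ_*}, ∘_ξ) ⇄ (Y,*,∘). -/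
/-- Let `(f,s) : (X,*,∘) ⇄ (Y,*,∘)` be a split epimorphism of digroups
with kernel `(K,*,∘)` (embedded by `j` onto `f⁻¹(1)`), canonical `*`-action `φ_*`,
canonical `∘`-action `φ_∘` and skewing index `ξ`. Then `θ(y,k) = k * s(y)` is a bijection
`Y×K → X` that is a group isomorphism `(Y×K, ⋉_{φ_*}) → (X,*)` and
`(Y×K, ∘_ξ) → (X,∘)` (where `∘_ξ` is built from `φ_∘` and `ξ`), with `f ∘ θ = p_Y` and
`θ ∘ ι_Y = s`; hence `(f,s)` is isomorphic to `(p_Y,ι_Y) : (Y×K, ⋉_{φ_*}, ∘_ξ) ⇄ (Y,*,∘)`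
in digroups. -/
theorem stmt7 {X Y K : Type*} (mX cX : GroupLaw X) (mY cY : GroupLaw Y)
    (mK cK : GroupLaw K)
    (hX : mX.one = cX.one) (hY : mY.one = cY.one) (hK : mK.one = cK.one)
    (f : X → Y) (s : Y → X)
    (hfm : ∀ a b, f (mX.mul a b) = mY.mul (f a) (f b))
    (hfc : ∀ a b, f (cX.mul a b) = cY.mul (f a) (f b))
    (hsm : ∀ a b, s (mY.mul a b) = mX.mul (s a) (s b))
    (hsc : ∀ a b, s (cY.mul a b) = cX.mul (s a) (s b))
    (hfs : ∀ y, f (s y) = y)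
    -- the kernel of `(f,s)`
    (j : K → X) (hj : Function.Injective j)
    (hjm : ∀ a b, j (mK.mul a b) = mX.mul (j a) (j b))
    (hjc : ∀ a b, j (cK.mul a b) = cX.mul (j a) (j b))
    (hjker : ∀ x, f x = mY.one ↔ ∃ k, j k = x)
    -- the canonical actions of `(f,s)`, transported to `K` through `j`
    (φm : Y → K → K)
    (hφm : ∀ y k, j (φm y k) = mX.mul (mX.mul (s y) (j k)) (mX.inv (s y)))
    (φc : Y → K → K)
    (hφc : ∀ y k, j (φc y k) = cX.mul (cX.mul (s y) (j k)) (cX.inv (s y)))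
    -- the skewing index of `(f,s)`, transported to `K` through `j`
    (ξ : Y → Equiv.Perm K)
    (hξ : ∀ y k, j (ξ y k) = mX.mul (cX.mul (j k) (s y)) (mX.inv (s y)))
    -- the comparison map `θ`
    (θ : Y × K → X) (hθ : ∀ p : Y × K, θ p = mX.mul (j p.2) (s p.1)) :
    Function.Bijective θ ∧
    -- `θ : (Y×K, ⋉_{φ_*}) → (X,*)` is a homomorphism
    (∀ p q : Y × K,
      θ (mY.mul p.1 q.1, mK.mul p.2 (φm p.1 q.2)) = mX.mul (θ p) (θ q)) ∧
    -- `θ : (Y×K, ∘_ξ) → (X,∘)` is a homomorphism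
    (∀ p q : Y × K,
      θ (cY.mul p.1 q.1, ξ (cY.mul p.1 q.1)
          (cK.mul ((ξ p.1).symm p.2) (φc p.1 ((ξ q.1).symm q.2))))
        = cX.mul (θ p) (θ q)) ∧
    (∀ p : Y × K, f (θ p) = p.1) ∧ (∀ y, θ (y, mK.one) = s y) := by
  have rc : ∀ (a b c : X), mX.mul a c = mX.mul b c → a = b := by
    intro a b c h
    have h2 := congrArg (fun z => mX.mul z (mX.inv c)) h
    simpa only [mX.mul_assoc, mX.mul_inv, mX.mul_one] using h2
  have rcY : ∀ (a b c : Y), mY.mul a c = mY.mul b c → a = b := by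
    intro a b c h
    have h2 := congrArg (fun z => mY.mul z (mY.inv c)) h
    simpa only [mY.mul_assoc, mY.mul_inv, mY.mul_one] using h2
  have hj1 : j mK.one = mX.one := by
    apply rc _ _ (j mK.one)
    rw [← hjm, mK.one_mul, mX.one_mul]
  have hfj : ∀ k, f (j k) = mY.one := fun k => (hjker _).2 ⟨k, rfl⟩
  have hfθ : ∀ p : Y × K, f (θ p) = p.1 := by
    intro p
    rw [hθ, hfm, hfj, hfs, mY.one_mul]
  have key : ∀ y k, θ (y, ξ y k) = cX.mul (j k) (s y) := by
    intro y k
    rw [hθ]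
    simp only [hξ]
    rw [mX.mul_assoc, mX.inv_mul, mX.mul_one]
  have key2 : ∀ p : Y × K, θ p = cX.mul (j ((ξ p.1).symm p.2)) (s p.1) := by
    intro p
    rw [← key, Equiv.apply_symm_apply]
  refine ⟨⟨?_, ?_⟩, ?_, ?_, hfθ, ?_⟩
  · rintro ⟨y, k⟩ ⟨y', k'⟩ h
    have h1 : y = y' := by
      have := congrArg f h
      rwa [hfθ, hfθ] at this
    subst h1
    rw [hθ, hθ] at h
    exact congrArg (Prod.mk y) (hj (rc _ _ _ h))
  · intro x
    obtain ⟨k, hk⟩ := (hjker (mX.mul x (mX.inv (s (f x))))).1 (by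
      apply rcY _ _ (f x)
      have h : f (mX.mul (mX.mul x (mX.inv (s (f x)))) (s (f x))) = f x := by
        rw [mX.mul_assoc, mX.inv_mul, mX.mul_one]
      rw [hfm, hfs] at h
      rw [h, mY.one_mul])
    refine ⟨(f x, k), ?_⟩
    rw [hθ]
    simp only [hk]
    rw [mX.mul_assoc, mX.inv_mul, mX.mul_one]
  · intro p q
    rw [hθ, hθ, hθ]
    simp only [hjm, hsm, hφm, mX.mul_assoc]
    rw [← mX.mul_assoc (mX.inv (s p.1)), mX.inv_mul, mX.one_mul]
  · intro p q
    rw [key, key2 p, key2 q]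
    simp only [hjc, hsc, hφc, cX.mul_assoc]
    rw [← cX.mul_assoc (cX.inv (s p.1)), cX.inv_mul, cX.one_mul]
  · intro y
    rw [hθ]
    simp only [hj1, mX.one_mul]
end

section
/- Let (f,s): (X,*,∘) ⇄ (Y,*,∘) be a split epimorphism of digroups with kernel K. Then (X,*,∘) is a skew brace (so that (f,s) is a split epimorphism of skew braces) if and only if, for every y ∈ Y and every k ∈ K, both λ_{s(y)}: (X,*) → (X,*) and λ_k: (X,*) → (X,*) are group homomorphisms. -/
theorem brace_comp {X : Type*} [Group X] (c : X → X → X)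
    (hc : ∀ a b d, c (c a b) d = c a (c b d)) (h1 : ∀ a, c a 1 = a) (a b : X)
    (ha : ∀ x y, c a (x * y) = c a x * a⁻¹ * c a y)
    (hb : ∀ x y, c b (x * y) = c b x * b⁻¹ * c b y) (x y : X) :
    c (c a b) (x * y) = c (c a b) x * (c a b)⁻¹ * c (c a b) y := by
  have h := ha b b⁻¹
  rw [mul_inv_cancel, h1] at h
  have h2 : c a b⁻¹ = a * (c a b)⁻¹ * a := by
    have : c a b⁻¹ = a * (c a b)⁻¹ * (c a b * a⁻¹ * c a b⁻¹) := by group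
    rw [← h] at this
    exact this
  rw [hc, hb, ha, ha, h2, hc, hc]
  group

theorem brace_iff {X : Type*} [Group X] (c : X → X → X) (a x y : X) :
    a⁻¹ * c a (x * y) = (a⁻¹ * c a x) * (a⁻¹ * c a y) ↔
      c a (x * y) = c a x * a⁻¹ * c a y := by
  rw [← mul_right_inj a⁻¹ (b := c a (x * y)) (c := c a x * a⁻¹ * c a y)]
  simp only [mul_assoc]

/-- Let `(f,s) : (X,*,∘) ⇄ (Y,*,∘)` be a split epimorphism of digroups
with kernel `K = f⁻¹(1)`. Then `(X,*,∘)` is a skew brace if and only if `λ_{s(y)}` and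
`λ_k` are group homomorphisms `(X,*) → (X,*)` for every `y ∈ Y` and `k ∈ K`, where
`λ_a(b) = a^{-*} * (a ∘ b)`. -/
theorem stmt9 {X Y : Type*} (mX cX : GroupLaw X) (mY cY : GroupLaw Y)
    (hX : mX.one = cX.one) (hY : mY.one = cY.one)
    (f : X → Y) (s : Y → X)
    (hfm : ∀ a b, f (mX.mul a b) = mY.mul (f a) (f b))
    (hfc : ∀ a b, f (cX.mul a b) = cY.mul (f a) (f b))
    (hsm : ∀ a b, s (mY.mul a b) = mX.mul (s a) (s b))
    (hsc : ∀ a b, s (cY.mul a b) = cX.mul (s a) (s b))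
    (hfs : ∀ y, f (s y) = y)
    (lam : X → X → X) (hlam : ∀ a b, lam a b = mX.mul (mX.inv a) (cX.mul a b)) :
    (∀ a b c : X, cX.mul a (mX.mul b c)
        = mX.mul (mX.mul (cX.mul a b) (mX.inv a)) (cX.mul a c))
    ↔ ((∀ (y : Y) (a b : X),
          lam (s y) (mX.mul a b) = mX.mul (lam (s y) a) (lam (s y) b)) ∧
       (∀ k : X, f k = mY.one → ∀ a b : X,
          lam k (mX.mul a b) = mX.mul (lam k a) (lam k b))) := by
  letI G : Group X :=
    { mul := mX.mul, one := mX.one, inv := mX.inv, mul_assoc := mX.mul_assoc,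
      one_mul := mX.one_mul, mul_one := mX.mul_one, inv_mul_cancel := mX.inv_mul }
  have key : ∀ a x y, lam a (mX.mul x y) = mX.mul (lam a x) (lam a y) ↔
      cX.mul a (mX.mul x y) = mX.mul (mX.mul (cX.mul a x) (mX.inv a)) (cX.mul a y) := by
    intro a x y
    rw [hlam, hlam, hlam]
    exact brace_iff cX.mul a x y
  simp only [key]
  constructor
  · intro h
    exact ⟨fun y a b => h _ a b, fun k _ a b => h k a b⟩
  · rintro ⟨hs, hk⟩ a
    have hs1 : s cY.one = cX.one := by
      have h := hsc cY.one cY.one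
      rw [cY.one_mul] at h
      have hh := congrArg (cX.mul (cX.inv (s cY.one))) h
      rw [← cX.mul_assoc, cX.inv_mul, cX.one_mul] at hh
      exact hh.symm
    have hf : f (cX.mul a (s (cY.inv (f a)))) = mY.one := by
      rw [hfc, hfs, cY.mul_inv, hY]
    have hdec : cX.mul (cX.mul a (s (cY.inv (f a)))) (s (f a)) = a := by
      rw [cX.mul_assoc, ← hsc, cY.inv_mul, hs1, cX.mul_one]
    have h := brace_comp cX.mul cX.mul_assoc
      (fun a => (congrArg (cX.mul a) hX).trans (cX.mul_one a)) _ _ (hk _ hf) (hs (f a))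
    rw [hdec] at h
    exact h
end

section
/- Let (Y,*,∘) and (K,*,∘) be skew braces and let ψ_*: (Y,*) → Aut(K,*) and ψ_∘: (Y,∘) → Aut(K,∘) be group actions. The digroup (Y×K, ⋉_{ψ_*}, ⋉_{ψ_∘}) is a skew brace (i.e., the split epimorphism (p_Y, ι_Y) onto (Y,*,∘) lies in skew braces) if and only if: (1) ψ_{∘y} is a group automorphism of (K,*) for every y ∈ Y; (2) ψ_{*y} ∘ λ^K_k = λ^K_k ∘ ψ_{*y} for all (y,k) ∈ Y×K; (3) ψ_{*((γ∘y)*γ^{-*})} = ψ_{∘γ} ∘ ψ_{*y} ∘ ψ_{∘γ}^{-1} for all (γ,y) ∈ Y×Y. -/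
/-- Let `(Y,*,∘)` and `(K,*,∘)` be skew braces, and
`ψ_* : (Y,*) → Aut(K,*)`, `ψ_∘ : (Y,∘) → Aut(K,∘)` group actions. The digroup
`(Y×K, ⋉_{ψ_*}, ⋉_{ψ_∘})` is a skew brace if and only if:
(1) `ψ_{∘y}` is a `*`-automorphism of `K` for all `y`;
(2) `ψ_{*y} ∘ λ^K_k = λ^K_k ∘ ψ_{*y}` for all `y`, `k`;
(3) `ψ_{*((γ∘y)*γ^{-*})} = ψ_{∘γ} ∘ ψ_{*y} ∘ ψ_{∘γ}⁻¹` for all `γ`, `y`. -/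
theorem stmt11 {Y K : Type*} (mY cY : GroupLaw Y) (mK cK : GroupLaw K)
    (hY : mY.one = cY.one) (hK : mK.one = cK.one)
    -- `(Y,*,∘)` and `(K,*,∘)` are skew braces
    (hbY : ∀ a b c : Y, cY.mul a (mY.mul b c)
        = mY.mul (mY.mul (cY.mul a b) (mY.inv a)) (cY.mul a c))
    (hbK : ∀ a b c : K, cK.mul a (mK.mul b c)
        = mK.mul (mK.mul (cK.mul a b) (mK.inv a)) (cK.mul a c))
    -- the pair of group actions
    (ψm ψc : Y → K → K)
    (hψm_bij : ∀ y, Function.Bijective (ψm y))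
    (hψm_hom : ∀ y a b, ψm y (mK.mul a b) = mK.mul (ψm y a) (ψm y b))
    (hψm_act : ∀ y y' k, ψm (mY.mul y y') k = ψm y (ψm y' k))
    (hψm_one : ∀ k, ψm mY.one k = k)
    (hψc_bij : ∀ y, Function.Bijective (ψc y))
    (hψc_hom : ∀ y a b, ψc y (cK.mul a b) = cK.mul (ψc y a) (ψc y b))
    (hψc_act : ∀ y y' k, ψc (cY.mul y y') k = ψc y (ψc y' k))
    (hψc_one : ∀ k, ψc cY.one k = k)
    -- the two semidirect product laws and the `⋉_{ψ_*}`-inverse on `Y × K`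
    (sdm sdc : Y × K → Y × K → Y × K) (sdmInv : Y × K → Y × K)
    (hsdm : ∀ p q, sdm p q = (mY.mul p.1 q.1, mK.mul p.2 (ψm p.1 q.2)))
    (hsdc : ∀ p q, sdc p q = (cY.mul p.1 q.1, cK.mul p.2 (ψc p.1 q.2)))
    (hsdmInv : ∀ p, sdmInv p = (mY.inv p.1, ψm (mY.inv p.1) (mK.inv p.2))) :
    -- `(Y×K, ⋉_{ψ_*}, ⋉_{ψ_∘})` is a skew brace
    (∀ a b c : Y × K, sdc a (sdm b c) = sdm (sdm (sdc a b) (sdmInv a)) (sdc a c))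
    ↔ ((∀ (y : Y) (a b : K), ψc y (mK.mul a b) = mK.mul (ψc y a) (ψc y b)) ∧
       (∀ (y : Y) (k kb : K),
          ψm y (mK.mul (mK.inv k) (cK.mul k kb))
            = mK.mul (mK.inv k) (cK.mul k (ψm y kb))) ∧
       (∀ (γ y : Y) (k : K),
          ψm (mY.mul (cY.mul γ y) (mY.inv γ)) (ψc γ k) = ψc γ (ψm y k))) := by
  have idem : ∀ a : K, cK.mul a a = a → a = cK.one := by
    intro a h
    rw [← cK.inv_mul a]
    conv_rhs => rw [← h, ← cK.mul_assoc]
    rw [h, cK.inv_mul, cK.one_mul]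
  have hc1 : ∀ y, ψc y mK.one = mK.one := by
    intro y
    rw [hK]
    apply idem
    rw [← hψc_hom, cK.one_mul]
  have iK : mK.inv mK.one = mK.one := by
    have := mK.inv_mul mK.one
    rwa [mK.mul_one] at this
  have iY : mY.inv mY.one = mY.one := by
    have := mY.inv_mul mY.one
    rwa [mY.mul_one] at this
  have coK : ∀ k, cK.mul mK.one k = k := by
    intro k
    rw [hK, cK.one_mul]
  have ocK : ∀ k, cK.mul k mK.one = k := by
    intro k
    rw [hK, cK.mul_one]
  have coY : ∀ k, cY.mul mY.one k = k := by
    intro k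
    rw [hY, cY.one_mul]
  have ocY : ∀ k, cY.mul k mY.one = k := by
    intro k
    rw [hY, cY.mul_one]
  have hc1' : ∀ k, ψc mY.one k = k := by
    intro k
    rw [hY, hψc_one]
  have key : (∀ a b c : Y × K, sdc a (sdm b c) = sdm (sdm (sdc a b) (sdmInv a)) (sdc a c)) ↔
      ∀ (γ y : Y) (k u w : K), cK.mul k (ψc γ (mK.mul u (ψm y w))) =
        mK.mul (cK.mul k (ψc γ u)) (ψm (mY.mul (cY.mul γ y) (mY.inv γ))
          (mK.mul (mK.inv k) (cK.mul k (ψc γ w)))) := by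
    constructor
    · intro h γ y k u w
      have := congrArg Prod.snd (h (γ, k) (y, u) (mY.one, w))
      simp only [hsdc, hsdm, hsdmInv] at this
      rw [this, mK.mul_assoc, ← hψm_act (cY.mul γ y), ← hψm_hom]
    · rintro h ⟨γ, k⟩ ⟨y, u⟩ ⟨z, w⟩
      simp only [hsdc, hsdm, hsdmInv]
      rw [hbY, h, mK.mul_assoc, ← hψm_act (cY.mul γ y), ← hψm_hom]
  rw [key]
  constructor
  · intro h
    refine ⟨?_, ?_, ?_⟩
    · intro y a b
      have := h y mY.one mK.one a b
      simpa only [coK, ocY, mY.mul_inv, hψm_one, iK, mK.one_mul] using this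
    · intro y k w
      have := h mY.one y k mK.one w
      simp only [coY, hc1', ocK, iY, mY.mul_one, mK.one_mul] at this
      rw [this, ← mK.mul_assoc, mK.inv_mul, mK.one_mul]
    · intro γ y w
      have := h γ y mK.one mK.one w
      simp only [coK, hc1, iK, mK.one_mul] at this
      exact this.symm
  · rintro ⟨h1, h2, h3⟩ γ y k u w
    rw [h1, hbK, h2, h3, mK.mul_assoc]
end

section
/- Let (Y,*,∘) be a skew brace, (A,+) an abelian group, and ψ: (Y,∘) → Aut(A,+) a group action. Then Y×A equipped with the two group laws (y,a) ⋆ (y',a') = (y*y', a + a') and (y,a) • (y',a') = (y∘y', a + ψ_y(a')) is a skew brace, and the projection p_Y: Y×A → Y is a homomorphism of skew braces onto (Y,*,∘) split by ι_Y(y) = (y,0), with abelian kernel (A,+,+). -/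
/-- Two group laws on the same carrier form a (left) skew brace when
`a • (b ⋆ c) = ((a • b) ⋆ a^{-⋆}) ⋆ (a • c)`. -/
def IsSkewBraceLaws {X : Type*} (L₁ L₂ : GroupLaw X) : Prop :=
  ∀ a b c : X, L₂.mul a (L₁.mul b c)
    = L₁.mul (L₁.mul (L₂.mul a b) (L₁.inv a)) (L₂.mul a c)

/-- Let `(Y,*,∘)` be a skew brace, `(A,+)` an abelian group and
`ψ : (Y,∘) → Aut(A,+)` a group action. Then `Y×A` with the laws
`(y,a) ⋆ (y',a') = (y*y', a+a')` and `(y,a) • (y',a') = (y∘y', a + ψ_y(a'))` is a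
skew brace; `p_Y` is a homomorphism of skew braces onto `(Y,*,∘)` split by
`ι_Y(y) = (y,0)`, with abelian kernel `(A,+,+)`. -/
theorem stmt13 {Y A : Type*} [AddCommGroup A]
    (mY cY : GroupLaw Y) (hone : mY.one = cY.one)
    (hbY : ∀ a b c : Y, cY.mul a (mY.mul b c)
        = mY.mul (mY.mul (cY.mul a b) (mY.inv a)) (cY.mul a c))
    (ψ : Y → A ≃+ A)
    (hψ_act : ∀ (y y' : Y) (a : A), ψ (cY.mul y y') a = ψ y (ψ y' a))
    (hψ_one : ∀ a : A, ψ cY.one a = a) :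
    ∃ L₁ L₂ : GroupLaw (Y × A),
      (∀ p q : Y × A, L₁.mul p q = (mY.mul p.1 q.1, p.2 + q.2)) ∧
      (∀ p q : Y × A, L₂.mul p q = (cY.mul p.1 q.1, p.2 + ψ p.1 q.2)) ∧
      L₁.one = (mY.one, (0 : A)) ∧ L₂.one = (mY.one, (0 : A)) ∧
      IsSkewBraceLaws L₁ L₂ ∧
      -- `p_Y` is a homomorphism onto `(Y,*,∘)`
      (∀ p q : Y × A, (L₁.mul p q).1 = mY.mul p.1 q.1) ∧
      (∀ p q : Y × A, (L₂.mul p q).1 = cY.mul p.1 q.1) ∧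
      -- `ι_Y(y) = (y,0)` is a section homomorphism for both laws
      (∀ y y' : Y, L₁.mul (y, 0) (y', 0) = (mY.mul y y', 0)) ∧
      (∀ y y' : Y, L₂.mul (y, 0) (y', 0) = (cY.mul y y', 0)) ∧
      -- the kernel of `p_Y` is the abelian skew brace `(A,+,+)`
      (∀ a b : A, L₁.mul (mY.one, a) (mY.one, b) = (mY.one, a + b)) ∧
      (∀ a b : A, L₂.mul (cY.one, a) (cY.one, b) = (cY.one, a + b)) := by
  refine ⟨
    { mul := fun p q => (mY.mul p.1 q.1, p.2 + q.2)
      one := (mY.one, 0)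
      inv := fun p => (mY.inv p.1, -p.2)
      mul_assoc := fun a b c => by simp [mY.mul_assoc, add_assoc]
      one_mul := fun a => by simp [mY.one_mul]
      mul_one := fun a => by simp [mY.mul_one]
      inv_mul := fun a => by simp [mY.inv_mul]
      mul_inv := fun a => by simp [mY.mul_inv] },
    { mul := fun p q => (cY.mul p.1 q.1, p.2 + ψ p.1 q.2)
      one := (cY.one, 0)
      inv := fun p => (cY.inv p.1, -(ψ (cY.inv p.1) p.2))
      mul_assoc := fun a b c => by simp [cY.mul_assoc, add_assoc, hψ_act]
      one_mul := fun a => by simp [cY.one_mul, hψ_one]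
      mul_one := fun a => by simp [cY.mul_one]
      inv_mul := fun a => by simp [cY.inv_mul]
      mul_inv := fun a => by simp [← hψ_act, cY.mul_inv, hψ_one] },
    fun _ _ => rfl, fun _ _ => rfl, rfl, by simp [hone], ?_,
    fun _ _ => rfl, fun _ _ => rfl, ?_, ?_, ?_, ?_⟩
  · intro a b c
    refine Prod.ext (hbY a.1 b.1 c.1) ?_
    simp only [map_add]
    abel
  · intro y y'
    simp
  · intro y y'
    simp
  · intro a b
    simp [mY.mul_one]
  · intro a b
    simp [cY.mul_one, hψ_one]
end

section
/- Let f: X → Y and f': X' → Y be surjective group homomorphisms and let v: X → X' be an injective group homomorphism with f' ∘ v = f. If v(ker f) is a normal subgroup of ker f', then v(ker f) is a normal subgroup of X'. -/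
/-- **Gerstenhaber's lemma.** Let `f : X → Y` and `f' : X' → Y` be
surjective group homomorphisms and `v : X → X'` an injective group homomorphism with
`f' ∘ v = f`. If `v(ker f)` is a normal subgroup of `ker f'`, then `v(ker f)` is a
normal subgroup of `X'`. -/
theorem stmt15 {X X' Y : Type*} [Group X] [Group X'] [Group Y]
    (f : X →* Y) (f' : X' →* Y) (v : X →* X')
    (hf : Function.Surjective f) (hf' : Function.Surjective f')
    (hv : Function.Injective v) (hcomp : ∀ x, f' (v x) = f x)
    (hnormal : ((f.ker.map v).subgroupOf f'.ker).Normal) :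
    (f.ker.map v).Normal := by
  constructor
  rintro n ⟨a, ha, rfl⟩ g
  have ha' : f a = 1 := ha
  obtain ⟨x, hx⟩ := hf (f' g)
  have hk : g * (v x)⁻¹ ∈ f'.ker := by
    rw [MonoidHom.mem_ker, map_mul, map_inv, hcomp, hx, mul_inv_cancel]
  have hb : f (x * a * x⁻¹) = 1 := by simp [ha']
  have hm : v (x * a * x⁻¹) ∈ f'.ker := by
    rw [MonoidHom.mem_ker, hcomp, hb]
  have h := hnormal.conj_mem ⟨v (x * a * x⁻¹), hm⟩
    (Subgroup.mem_subgroupOf.mpr ⟨x * a * x⁻¹, hb, rfl⟩) ⟨g * (v x)⁻¹, hk⟩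
  have h2 := Subgroup.mem_subgroupOf.mp h
  have e : g * v a * g⁻¹ = (g * (v x)⁻¹) * v (x * a * x⁻¹) * (g * (v x)⁻¹)⁻¹ := by
    simp only [map_mul, map_inv]
    group
  rw [e]
  exact h2
end

section
/- Let (f,s): X ⇄ Y and (f',s'): X' ⇄ Y be split epimorphisms of skew braces (f, f', s, s' are homomorphisms for both laws, with f∘s = id_Y = f'∘s'), and let v: X → X' be an injective homomorphism of skew braces with f'∘v = f and v∘s = s'. If v(Ker f) is an ideal of the skew brace Ker f' = f'⁻¹(1), then v(Ker f) is an ideal of X'. (This is the concrete content of the theorem that the category of left skew braces is strongly protomodular.) -/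
/-- `K` is an ideal of the sub-skew brace `H` of `(G, L₁, L₂)`: `K ⊆ H`, `K` is a
subgroup for both laws, `K` is normal in `(H,∘)`, `K*a = a*K` for all `a ∈ H`, and
`λ_a(K) ⊆ K` for all `a ∈ H` (where `λ_a(b) = a^{-*}*(a∘b)`). Taking `H = univ`
gives the notion of ideal of `(G, L₁, L₂)` itself. -/
def IsIdealIn {G : Type*} (L₁ L₂ : GroupLaw G) (H K : Set G) : Prop :=
  K ⊆ H ∧ L₁.one ∈ K ∧
  (∀ a ∈ K, ∀ b ∈ K, L₁.mul a b ∈ K) ∧ (∀ a ∈ K, L₁.inv a ∈ K) ∧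
  (∀ a ∈ K, ∀ b ∈ K, L₂.mul a b ∈ K) ∧ (∀ a ∈ K, L₂.inv a ∈ K) ∧
  (∀ g ∈ H, ∀ a ∈ K, L₂.mul (L₂.mul g a) (L₂.inv g) ∈ K) ∧
  (∀ g ∈ H, (fun a => L₁.mul a g) '' K = (fun a => L₁.mul g a) '' K) ∧
  (∀ g ∈ H, ∀ a ∈ K, L₁.mul (L₁.inv g) (L₂.mul g a) ∈ K)

namespace GroupLaw

theorem inv_mul_left {X : Type*} (L : GroupLaw X) (a b : X) :
    L.mul (L.inv a) (L.mul a b) = b := by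
  rw [← L.mul_assoc, L.inv_mul, L.one_mul]

theorem mul_inv_left {X : Type*} (L : GroupLaw X) (a b : X) :
    L.mul a (L.mul (L.inv a) b) = b := by
  rw [← L.mul_assoc, L.mul_inv, L.one_mul]

theorem left_cancel {X : Type*} (L : GroupLaw X) {a b c : X}
    (h : L.mul a b = L.mul a c) : b = c := by
  rw [← L.inv_mul_left a b, h, L.inv_mul_left]

theorem inv_unique {X : Type*} (L : GroupLaw X) {a b : X}
    (h : L.mul a b = L.one) : b = L.inv a :=
  L.left_cancel (a := a) (by rw [h, L.mul_inv])

theorem inv_inv {X : Type*} (L : GroupLaw X) (a : X) : L.inv (L.inv a) = a :=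
  (L.inv_unique (L.inv_mul a)).symm

theorem inv_mul_rev {X : Type*} (L : GroupLaw X) (a b : X) :
    L.inv (L.mul a b) = L.mul (L.inv b) (L.inv a) :=
  (L.inv_unique (by rw [L.mul_assoc, L.mul_inv_left, L.mul_inv])).symm

theorem map_one {X Y : Type*} (L : GroupLaw X) (M : GroupLaw Y) (f : X → Y)
    (hf : ∀ a b, f (L.mul a b) = M.mul (f a) (f b)) : f L.one = M.one :=
  M.left_cancel (a := f L.one) (by rw [← hf, L.one_mul, M.mul_one])

theorem map_inv {X Y : Type*} (L : GroupLaw X) (M : GroupLaw Y) (f : X → Y)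
    (hf : ∀ a b, f (L.mul a b) = M.mul (f a) (f b)) (a : X) :
    f (L.inv a) = M.inv (f a) :=
  M.inv_unique (by rw [← hf, L.mul_inv, L.map_one M f hf])

/-- The two units of a skew brace agree. -/
theorem one_eq {X : Type*} (m c : GroupLaw X)
    (hb : ∀ x y z : X, c.mul x (m.mul y z)
      = m.mul (m.mul (c.mul x y) (m.inv x)) (c.mul x z)) : m.one = c.one := by
  have h := hb c.one m.one m.one
  simp only [c.one_mul, m.one_mul, m.mul_one] at h
  rw [← m.inv_inv c.one, ← h]
  exact m.inv_unique (m.one_mul _)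

/-- `lam` is multiplicative for the circle law. -/
theorem lam_mul {X : Type*} (m c : GroupLaw X)
    (hb : ∀ x y z : X, c.mul x (m.mul y z)
      = m.mul (m.mul (c.mul x y) (m.inv x)) (c.mul x z)) (a b z : X) :
    m.mul (m.inv a) (c.mul a (m.mul (m.inv b) (c.mul b z)))
      = m.mul (m.inv (c.mul a b)) (c.mul (c.mul a b) z) := by
  have h1 : c.mul a m.one = a := by rw [one_eq m c hb, c.mul_one]
  have h2 := hb a b (m.mul (m.inv b) (c.mul b z))
  rw [m.mul_inv_left, ← c.mul_assoc, m.mul_assoc] at h2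
  rw [h2, m.inv_mul_left]

/-- Conjugation-stability extends from the kernel to the whole group. -/
theorem conj_mem {X X' Y : Type*} (L : GroupLaw X) (L' : GroupLaw X') (M : GroupLaw Y)
    (f : X → Y) (s : Y → X) (f' : X' → Y) (s' : Y → X') (v : X → X')
    (hf : ∀ a b, f (L.mul a b) = M.mul (f a) (f b))
    (hf' : ∀ a b, f' (L'.mul a b) = M.mul (f' a) (f' b))
    (hf's' : ∀ y, f' (s' y) = y)
    (hvm : ∀ a b, v (L.mul a b) = L'.mul (v a) (v b))
    (hvs : ∀ y, v (s y) = s' y)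
    (hk : ∀ g, f' g = M.one → ∀ a ∈ v '' {x | f x = M.one},
      L'.mul (L'.mul g a) (L'.inv g) ∈ v '' {x | f x = M.one})
    (g : X') (a : X') (ha : a ∈ v '' {x | f x = M.one}) :
    L'.mul (L'.mul g a) (L'.inv g) ∈ v '' {x | f x = M.one} := by
  obtain ⟨x, hx, rfl⟩ := ha
  have hx' : f x = M.one := hx
  have h := hk (L'.mul g (L'.inv (s' (f' g))))
    (by rw [hf', L'.map_inv M f' hf', hf's', M.mul_inv])
    (v (L.mul (L.mul (s (f' g)) x) (L.inv (s (f' g)))))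
    ⟨_, by
      show f _ = _
      rw [hf, hf, L.map_inv M f hf, hx', M.mul_one, M.mul_inv], rfl⟩
  rw [hvm, hvm, L.map_inv L' v hvm, hvs] at h
  simpa only [L'.mul_assoc, L'.inv_mul_rev, L'.inv_inv, L'.inv_mul_left,
    L'.mul_inv_left] using h

end GroupLaw

/-- **strong protomodularity of skew braces.** Let
`(f,s) : X ⇄ Y` and `(f',s') : X' ⇄ Y` be split epimorphisms of skew braces and
`v : X → X'` an injective homomorphism of skew braces with `f' ∘ v = f` and
`v ∘ s = s'`. If `v(Ker f)` is an ideal of the skew brace `Ker f'`, then `v(Ker f)`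
is an ideal of `X'`. -/
theorem stmt16 {X X' Y : Type*}
    (mX cX : GroupLaw X) (mX' cX' : GroupLaw X') (mY cY : GroupLaw Y)
    (hbX : ∀ a b c : X, cX.mul a (mX.mul b c)
        = mX.mul (mX.mul (cX.mul a b) (mX.inv a)) (cX.mul a c))
    (hbX' : ∀ a b c : X', cX'.mul a (mX'.mul b c)
        = mX'.mul (mX'.mul (cX'.mul a b) (mX'.inv a)) (cX'.mul a c))
    (hbY : ∀ a b c : Y, cY.mul a (mY.mul b c)
        = mY.mul (mY.mul (cY.mul a b) (mY.inv a)) (cY.mul a c))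
    (f : X → Y) (s : Y → X) (f' : X' → Y) (s' : Y → X') (v : X → X')
    (hfm : ∀ a b, f (mX.mul a b) = mY.mul (f a) (f b))
    (hfc : ∀ a b, f (cX.mul a b) = cY.mul (f a) (f b))
    (hsm : ∀ a b, s (mY.mul a b) = mX.mul (s a) (s b))
    (hsc : ∀ a b, s (cY.mul a b) = cX.mul (s a) (s b))
    (hfs : ∀ y, f (s y) = y)
    (hf'm : ∀ a b, f' (mX'.mul a b) = mY.mul (f' a) (f' b))
    (hf'c : ∀ a b, f' (cX'.mul a b) = cY.mul (f' a) (f' b))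
    (hs'm : ∀ a b, s' (mY.mul a b) = mX'.mul (s' a) (s' b))
    (hs'c : ∀ a b, s' (cY.mul a b) = cX'.mul (s' a) (s' b))
    (hf's' : ∀ y, f' (s' y) = y)
    (hv : Function.Injective v)
    (hvm : ∀ a b, v (mX.mul a b) = mX'.mul (v a) (v b))
    (hvc : ∀ a b, v (cX.mul a b) = cX'.mul (v a) (v b))
    (hf'v : ∀ x, f' (v x) = f x)
    (hvs : ∀ y, v (s y) = s' y)
    (hideal : IsIdealIn mX' cX' {x' | f' x' = mY.one} (v '' {x | f x = mY.one})) :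
    IsIdealIn mX' cX' Set.univ (v '' {x | f x = mY.one}) := by
  obtain ⟨h1, h2, h3, h4, h5, h6, h7, h8, h9⟩ := hideal
  have e : mY.one = cY.one := GroupLaw.one_eq mY cY hbY
  have hc : ∀ g, ∀ a ∈ v '' {x | f x = mY.one},
      mX'.mul (mX'.mul g a) (mX'.inv g) ∈ v '' {x | f x = mY.one} := by
    refine GroupLaw.conj_mem mX mX' mY f s f' s' v hfm hf'm hf's' hvm hvs ?_
    intro g hg a ha
    have : mX'.mul g a ∈ (fun a => mX'.mul g a) '' (v '' {x | f x = mY.one}) :=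
      ⟨a, ha, rfl⟩
    rw [← h8 g hg] at this
    obtain ⟨b, hb, hbe⟩ := this
    have hbe' : mX'.mul b g = mX'.mul g a := hbe
    rw [← hbe', mX'.mul_assoc, mX'.mul_inv, mX'.mul_one]
    exact hb
  refine ⟨Set.subset_univ _, h2, h3, h4, h5, h6, ?_, ?_, ?_⟩
  · intro g _
    rw [e]
    refine GroupLaw.conj_mem cX cX' cY f s f' s' v hfc hf'c hf's' hvc hvs ?_ g
    rw [← e]
    exact h7
  · intro g _
    ext z
    constructor
    · rintro ⟨a, ha, rfl⟩
      refine ⟨_, hc (mX'.inv g) a ha, ?_⟩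
      simp only [mX'.inv_inv, mX'.mul_assoc, mX'.mul_inv_left]
    · rintro ⟨a, ha, rfl⟩
      refine ⟨_, hc g a ha, ?_⟩
      simp only [mX'.mul_assoc, mX'.inv_mul, mX'.mul_one]
  · rintro g _ _ ⟨x, hx, rfl⟩
    have hx' : f x = mY.one := hx
    have h := h9 (cX'.mul g (cX'.inv (s' (f' g))))
      (by
        show f' _ = _
        rw [hf'c, cX'.map_inv cY f' hf'c, hf's', cY.mul_inv, e])
      (v (mX.mul (mX.inv (s (f' g))) (cX.mul (s (f' g)) x)))
      ⟨_, by
        show f _ = _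
        rw [hfm, hfc, mX.map_inv mY f hfm, hx', e, cY.mul_one, mY.inv_mul, e], rfl⟩
    rw [hvm, hvc, mX.map_inv mX' v hvm, hvs, GroupLaw.lam_mul mX' cX' hbX',
      cX'.mul_assoc g, cX'.inv_mul, cX'.mul_one] at h
    exact h
end

section
/- Let f: (X,*,∘) → (Y,*,∘) be a surjective homomorphism of skew braces whose kernel A = f⁻¹(1) is abelian (a*b = a∘b for all a,b ∈ A and * is commutative on A). Then: (1) λ_a(b) = b for all a,b ∈ A; (2) if f(x) = f(x') then λ_x(a) = λ_{x'}(a) for every a ∈ A; (3) if f(u) = f(v) = f(w) then u*v^{-*}*w = u∘v^{-∘}∘w; (4) for every y ∈ Y and a ∈ A, the element (a∘x)*x^{-*} ∈ A is independent of the choice of x with f(x) = y, so it defines a map ξ^f_y: A → A. -/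
theorem GroupLaw.inv_mul_cancel_left {X : Type*} (g : GroupLaw X) (a b : X) :
    g.mul (g.inv a) (g.mul a b) = b := by
  rw [← g.mul_assoc, g.inv_mul, g.one_mul]

theorem GroupLaw.mul_inv_cancel_left {X : Type*} (g : GroupLaw X) (a b : X) :
    g.mul a (g.mul (g.inv a) b) = b := by
  rw [← g.mul_assoc, g.mul_inv, g.one_mul]

theorem GroupLaw.left_cancel_s17 {X : Type*} (g : GroupLaw X) {a b c : X}
    (h : g.mul a b = g.mul a c) : b = c := by
  rw [← g.inv_mul_cancel_left a b, h, g.inv_mul_cancel_left]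

theorem GroupLaw.one_eq_s17 {X : Type*} (m c : GroupLaw X)
    (hb : ∀ x y z : X, c.mul x (m.mul y z)
        = m.mul (m.mul (c.mul x y) (m.inv x)) (c.mul x z)) : c.one = m.one := by
  have h := hb c.one m.one m.one
  simp only [c.one_mul, m.one_mul, m.mul_one] at h
  have h2 := congrArg (fun t => m.mul t c.one) h
  simp only [m.one_mul, m.inv_mul] at h2
  exact h2

/-- Let `f : (X,*,∘) → (Y,*,∘)` be a surjective homomorphism of
skew braces with abelian kernel `A = f⁻¹(1)`. Then:
(1) `λ_a(b) = b` for all `a, b ∈ A`;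
(2) `f(x) = f(x')` implies `λ_x(a) = λ_{x'}(a)` for all `a ∈ A`;
(3) `f(u) = f(v) = f(w)` implies `u*v^{-*}*w = u∘v^{-∘}∘w`;
(4) for `a ∈ A`, the element `(a∘x)*x^{-*}` lies in `A` and is independent of the
choice of `x` with `f(x) = y`, so it defines a map `ξ^f_y : A → A`. -/
theorem stmt17 {X Y : Type*} (mX cX : GroupLaw X) (mY cY : GroupLaw Y)
    (hbX : ∀ a b c : X, cX.mul a (mX.mul b c)
        = mX.mul (mX.mul (cX.mul a b) (mX.inv a)) (cX.mul a c))
    (hbY : ∀ a b c : Y, cY.mul a (mY.mul b c)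
        = mY.mul (mY.mul (cY.mul a b) (mY.inv a)) (cY.mul a c))
    (f : X → Y) (hf : Function.Surjective f)
    (hfm : ∀ a b, f (mX.mul a b) = mY.mul (f a) (f b))
    (hfc : ∀ a b, f (cX.mul a b) = cY.mul (f a) (f b))
    -- the kernel `A = f⁻¹(1)` is abelian
    (habelian : ∀ a b : X, f a = mY.one → f b = mY.one →
      mX.mul a b = cX.mul a b ∧ mX.mul a b = mX.mul b a)
    (lam : X → X → X) (hlam : ∀ a b, lam a b = mX.mul (mX.inv a) (cX.mul a b)) :
    -- (1)
    (∀ a b : X, f a = mY.one → f b = mY.one → lam a b = b) ∧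
    -- (2)
    (∀ x x' : X, f x = f x' → ∀ a : X, f a = mY.one → lam x a = lam x' a) ∧
    -- (3)
    (∀ u v w : X, f u = f v → f v = f w →
      mX.mul (mX.mul u (mX.inv v)) w = cX.mul (cX.mul u (cX.inv v)) w) ∧
    -- (4)
    (∀ a : X, f a = mY.one →
      (∀ x : X, f (mX.mul (cX.mul a x) (mX.inv x)) = mY.one) ∧
      ∀ x x' : X, f x = f x' →
        mX.mul (cX.mul a x) (mX.inv x) = mX.mul (cX.mul a x') (mX.inv x')) := by
  have hone := mY.one_eq_s17 cY hbY
  have key : ∀ x x' : X, f x = f x' → f (cX.mul (cX.inv x') x) = mY.one := by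
    intro x x' h
    apply cY.left_cancel_s17 (a := f x')
    rw [← hfc, cX.mul_inv_cancel_left, ← hone, cY.mul_one, h]
  have h2 : ∀ x x' : X, f x = f x' → ∀ a : X, f a = mY.one → lam x a = lam x' a := by
    intro x x' h a ha
    have hk := key x x' h
    have e := hbX x' (cX.mul (cX.inv x') x) a
    rw [(habelian _ _ hk ha).1, cX.mul_assoc (cX.inv x'), cX.mul_inv_cancel_left,
      cX.mul_inv_cancel_left, mX.mul_assoc] at e
    rw [hlam, hlam, e, mX.inv_mul_cancel_left]
  have h3 : ∀ u v w : X, f u = f v → f v = f w →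
      mX.mul (mX.mul u (mX.inv v)) w = cX.mul (cX.mul u (cX.inv v)) w := by
    intro u v w huv hvw
    have e := h2 u v huv _ (key w v hvw.symm)
    rw [hlam, hlam, cX.mul_inv_cancel_left] at e
    rw [mX.mul_assoc, ← e, mX.mul_inv_cancel_left, cX.mul_assoc]
  refine ⟨?_, h2, h3, ?_⟩
  · intro a b ha hb
    rw [hlam, ← (habelian a b ha hb).1, mX.inv_mul_cancel_left]
  · intro a ha
    have hax : ∀ x, f (cX.mul a x) = f x := by
      intro x
      rw [hfc, ha, ← hone, cY.one_mul]
    constructor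
    · intro x
      rw [hfm, hax, ← hfm, mX.mul_inv]
      apply mY.left_cancel_s17 (a := f mX.one)
      rw [← hfm, mX.one_mul, mY.mul_one]
    · intro x x' h
      have e := h3 (cX.mul a x) x x' (hax x) h
      rw [cX.mul_assoc a, cX.mul_inv, cX.mul_one] at e
      rw [← e, mX.mul_assoc _ x', mX.mul_inv, mX.mul_one]
end
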